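/- For all functions a, b : Fin n → ℕ, one has the operator identity (∏_{j} D_j^{a_j}) ∘ (∏_{j} X̂_j^{b_j}) ∘ (∏_{j} X̂_j^{a_j}) ∘ (∏_{j} D_j^{b_j}) = (∏_{j} ∏_{k=1}^{a_j} (E_j + k·id)) ∘ (∏_{j} ∏_{k=0}^{b_j−1} (E_j − k·id)) in End_R(R[X_1,…,X_n]); all factors appearing in each displayed product pairwise commute, so the products are unambiguous. (This is the identity g̃_v · f̃_v = ∏_j ∏_{k=1}^{⟨v,ẽ_j⟩}(E_j+k) · ∏_j ∏_{k=0}^{⟨v,ẽ_{n+j}⟩−1}(E_j−k) from the paper's proof of the existence of integral localizing parameters for hypertoric varieties in characteristic p.) -/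

import Mathlib

open MvPolynomial

/-- Multiplication by the variable `X j`, as an `R`-linear endomorphism of
`R[X_1, …, X_n]`. -/
noncomputable def Xhat {R : Type*} [CommRing R] {n : ℕ} (j : Fin n) :
    Module.End R (MvPolynomial (Fin n) R) :=
  LinearMap.mulLeft R (X j)

/-- The formal `j`-th partial derivative, as an `R`-linear endomorphism of
`R[X_1, …, X_n]`. -/
noncomputable def Dop {R : Type*} [CommRing R] {n : ℕ} (j : Fin n) :
    Module.End R (MvPolynomial (Fin n) R) :=
  (pderiv j).toLinearMap

/-- The `j`-th Euler operator `E_j = X̂_j ∘ D_j`. -/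
noncomputable def Eop {R : Type*} [CommRing R] {n : ℕ} (j : Fin n) :
    Module.End R (MvPolynomial (Fin n) R) :=
  Xhat j * Dop j

theorem List.prod_ofFn_mul_prod_ofFn_of_commute {M : Type*} [Monoid M] {n : ℕ} (f g : Fin n → M)
    (h : ∀ i j, i ≠ j → Commute (f i) (g j)) :
    (List.ofFn f).prod * (List.ofFn g).prod = (List.ofFn fun j => f j * g j).prod := by
  induction n with
  | zero => simp
  | succ n ih =>
    have hc : Commute (List.ofFn fun i => f (Fin.succ i)).prod (g 0) := by
      refine Commute.list_prod_left _ _ fun x hx => ?_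
      obtain ⟨i, rfl⟩ := (List.mem_ofFn' _ _).1 hx
      exact h _ _ (Fin.succ_ne_zero i)
    rw [List.ofFn_succ, List.ofFn_succ, List.ofFn_succ, List.prod_cons, List.prod_cons,
      List.prod_cons, ← ih _ _ fun i j hij => h _ _ fun he => hij (Fin.succ_injective _ he)]
    simp only [mul_assoc]
    rw [← mul_assoc _ (g 0), hc.eq, mul_assoc]

section Weyl

variable {A : Type*} [Ring A] {d x : A}

theorem mul_pow_succ_of_weyl (h : d * x = x * d + 1) (m : ℕ) :
    d * x ^ (m + 1) = x ^ m * (x * d + (m + 1) • (1 : A)) := by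
  induction m with
  | zero => simpa using h
  | succ m ih =>
    rw [pow_succ x (m + 1), ← mul_assoc, ih, pow_succ x m, mul_assoc, mul_assoc]
    congr 1
    rw [add_mul, mul_assoc x d x, h, succ_nsmul _ (m + 1)]
    simp only [smul_mul_assoc, one_mul, mul_add, mul_one, mul_smul_comm]
    abel

theorem mul_mul_pow_of_weyl (h : d * x = x * d + 1) (m : ℕ) :
    x * d * d ^ m = d ^ m * (x * d - m • (1 : A)) := by
  induction m with
  | zero => simp
  | succ m ih =>
    have hd : (x * d - m • (1 : A)) * d = d * (x * d - (m + 1) • (1 : A)) := by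
      rw [mul_sub, ← mul_assoc d x d, h, succ_nsmul]
      simp only [smul_mul_assoc, one_mul, mul_add, mul_one, mul_smul_comm, add_mul, sub_mul]
      abel
    rw [pow_succ, ← mul_assoc, ih, mul_assoc, hd, mul_assoc]

theorem pow_mul_pow_eq_prod_add_of_weyl (h : d * x = x * d + 1) (m : ℕ) :
    d ^ m * x ^ m = ((List.range m).map fun k => x * d + (k + 1) • (1 : A)).prod := by
  induction m with
  | zero => simp
  | succ m ih =>
    rw [List.prod_range_succ, ← ih, pow_succ d, mul_assoc, mul_pow_succ_of_weyl h, mul_assoc]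

theorem pow_mul_pow_eq_prod_sub_of_weyl (h : d * x = x * d + 1) (m : ℕ) :
    x ^ m * d ^ m = ((List.range m).map fun k => x * d - k • (1 : A)).prod := by
  induction m with
  | zero => simp
  | succ m ih =>
    rw [List.prod_range_succ, ← ih, pow_succ x, pow_succ' d, mul_assoc, ← mul_assoc x,
      mul_mul_pow_of_weyl h, mul_assoc]

end Weyl

section Operators

variable {R : Type*} [CommRing R] {n : ℕ}

theorem dop_mul_xhat_self (j : Fin n) :
    Dop (R := R) j * Xhat j = Xhat j * Dop j + 1 := by
  refine LinearMap.ext fun p => ?_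
  simp [Dop, Xhat, add_comm]

theorem commute_dop_xhat {i j : Fin n} (hij : i ≠ j) :
    Commute (Dop (R := R) i) (Xhat j) := by
  refine LinearMap.ext fun p => ?_
  simp [Dop, Xhat, pderiv_X_of_ne hij.symm]

theorem commute_xhat_xhat (i j : Fin n) : Commute (Xhat (R := R) i) (Xhat j) := by
  refine LinearMap.ext fun p => ?_
  simp [Xhat, mul_left_comm]

theorem commute_prod_ofFn_xhat_pow (a b : Fin n → ℕ) :
    Commute (List.ofFn fun j => Xhat (R := R) j ^ a j).prod
      (List.ofFn fun j => Xhat (R := R) j ^ b j).prod := by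
  refine Commute.list_prod_left _ _ fun y hy => Commute.list_prod_right _ _ fun z hz => ?_
  obtain ⟨i, rfl⟩ := (List.mem_ofFn' _ _).1 hy
  obtain ⟨j, rfl⟩ := (List.mem_ofFn' _ _).1 hz
  exact (commute_xhat_xhat i j).pow_pow _ _

end Operators

/-- The operator identity
`(∏_j D_j^{a_j}) ∘ (∏_j X̂_j^{b_j}) ∘ (∏_j X̂_j^{a_j}) ∘ (∏_j D_j^{b_j})
  = ∏_j ∏_{k=1}^{a_j}(E_j + k) · ∏_j ∏_{k=0}^{b_j-1}(E_j - k)`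
in `End_R(R[X_1, …, X_n])`.  All factors in each displayed product pairwise
commute, so the products are unambiguously expressed as products of lists. -/
theorem dop_xhat_xhat_dop_eq_euler_prod {R : Type*} [CommRing R] {n : ℕ}
    (a b : Fin n → ℕ) :
    (List.ofFn fun j => Dop (R := R) j ^ a j).prod *
      (List.ofFn fun j => Xhat (R := R) j ^ b j).prod *
      (List.ofFn fun j => Xhat (R := R) j ^ a j).prod *
      (List.ofFn fun j => Dop (R := R) j ^ b j).prod =
    (List.ofFn fun j : Fin n =>
        ((List.range (a j)).map fun k =>
          Eop (R := R) j + (k + 1) • (1 : Module.End R (MvPolynomial (Fin n) R))).prod).prod *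
    (List.ofFn fun j : Fin n =>
        ((List.range (b j)).map fun k =>
          Eop (R := R) j - k • (1 : Module.End R (MvPolynomial (Fin n) R))).prod).prod := by
  rw [mul_assoc _ (List.ofFn fun j => Xhat (R := R) j ^ b j).prod,
    (commute_prod_ofFn_xhat_pow b a).eq, ← mul_assoc, mul_assoc,
    List.prod_ofFn_mul_prod_ofFn_of_commute _ _ fun i j hij =>
      (commute_dop_xhat hij).pow_pow (a i) (a j),
    List.prod_ofFn_mul_prod_ofFn_of_commute _ _ fun i j hij =>
      (commute_dop_xhat hij.symm).symm.pow_pow (b i) (b j)]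
  simp only [pow_mul_pow_eq_prod_add_of_weyl (dop_mul_xhat_self _),
    pow_mul_pow_eq_prod_sub_of_weyl (dop_mul_xhat_self _), Eop]
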